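/- Let n ≥ 1 be an integer, let C > 0, and let K : ℤ² → (0,∞) be a kernel satisfying K(m) ≤ C·(1+|m|²)^{−1} for all m ∈ ℤ². Then for every ε ∈ (0,1) there exists a constant C_ε > 0, depending only on C, n, ε, such that for every m ∈ ℤ², K⋆ⁿK(m) ≤ C_ε·(1+|m|²)^{ε−1} and sup_{N≥1} K⋆ⁿ_{≤N}K(m) ≤ C_ε·(1+|m|²)^{ε−1}. -/

import Mathlib

open scoped BigOperators

/-- Squared Euclidean norm of a lattice point of `ℤ²`. -/
noncomputable def nsq (m : ℤ × ℤ) : ℝ := (m.1 : ℝ) ^ 2 + (m.2 : ℝ) ^ 2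

/-- Euclidean norm of a lattice point of `ℤ²`. -/
noncomputable def norm2 (m : ℤ × ℤ) : ℝ := Real.sqrt (nsq m)

/-- Convolution of two kernels on `ℤ²`: `K₁⋆K₂(m) = Σ_{l∈ℤ²} K₁(m−l)K₂(l)`. -/
noncomputable def conv (K₁ K₂ : ℤ × ℤ → ℝ) (m : ℤ × ℤ) : ℝ :=
  ∑' l : ℤ × ℤ, K₁ (m - l) * K₂ l

/-- Truncated convolution: `K₁⋆_{≤N}K₂(m) = Σ_{|l|≤N} K₁(m−l)K₂(l)`. -/
noncomputable def convLE (N : ℕ) (K₁ K₂ : ℤ × ℤ → ℝ) (m : ℤ × ℤ) : ℝ :=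
  ∑' l : ℤ × ℤ,
    Set.indicator {l : ℤ × ℤ | norm2 l ≤ (N : ℝ)} (fun l => K₁ (m - l) * K₂ l) l

/-- Iterated convolution `K⋆ⁿK`, with `K⋆¹K = K` and `K⋆ⁿK = K⋆(K⋆ⁿ⁻¹K)`. -/
noncomputable def iterConv (K : ℤ × ℤ → ℝ) : ℕ → ℤ × ℤ → ℝ
  | 0 => fun _ => 0
  | 1 => K
  | (n + 2) => conv K (iterConv K (n + 1))

/-- Truncated iterated convolution `K⋆ⁿ_{≤N}K`, with `K⋆¹_{≤N}K = K` and
`K⋆ⁿ_{≤N}K = K⋆_{≤N}(K⋆ⁿ⁻¹_{≤N}K)`. -/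
noncomputable def iterConvLE (N : ℕ) (K : ℤ × ℤ → ℝ) : ℕ → ℤ × ℤ → ℝ
  | 0 => fun _ => 0
  | 1 => K
  | (n + 2) => convLE N K (iterConvLE N K (n + 1))

/-- Tail of the iterated convolution: `K⋆ⁿ_{>N}K = K⋆ⁿK − K⋆ⁿ_{≤N}K`. -/
noncomputable def iterConvGT (N : ℕ) (K : ℤ × ℤ → ℝ) (n : ℕ) (m : ℤ × ℤ) : ℝ :=
  iterConv K n m - iterConvLE N K n m

lemma nsq_nonneg (m : ℤ × ℤ) : 0 ≤ nsq m := by unfold nsq; positivity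

lemma one_add_nsq_pos (m : ℤ × ℤ) : 0 < 1 + nsq m := by linarith [nsq_nonneg m]

lemma nsq_peetre (m l : ℤ × ℤ) : 1 + nsq m ≤ 2 * (1 + nsq (m - l)) + 2 * (1 + nsq l) := by
  simp only [nsq, Prod.fst_sub, Prod.snd_sub, Int.cast_sub]
  nlinarith [sq_nonneg ((m.1 : ℝ) - 2 * l.1), sq_nonneg ((m.2 : ℝ) - 2 * l.2)]

/-- one-dimensional summability -/
lemma summable_one_dim (s : ℝ) (hs : 1 < s) :
    Summable (fun x : ℤ => (1 + (x : ℝ) ^ 2) ^ (-(s / 2))) := by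
  have h1 := Real.summable_abs_int_rpow hs
  have h2 : Summable (fun x : ℤ => if x = 0 then (1 : ℝ) else 0) :=
    (hasSum_ite_eq (0 : ℤ) (1 : ℝ)).summable
  refine Summable.of_nonneg_of_le (fun x => by positivity) (fun x => ?_) (h1.add h2)
  by_cases hx : x = 0
  · subst hx
    simp
    positivity
  · have hx' : 0 < |(x : ℝ)| := abs_pos.mpr (by exact_mod_cast hx)
    have e : |(x : ℝ)| ^ (-s) = ((x : ℝ) ^ 2) ^ (-(s / 2)) := by
      rw [← sq_abs, ← Real.rpow_natCast, ← Real.rpow_mul hx'.le]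
      congr 1
      push_cast
      ring
    simp only [hx, if_false, add_zero]
    rw [e]
    apply Real.rpow_le_rpow_of_nonpos
    · rw [← sq_abs]; positivity
    · linarith
    · linarith

/-- summability on the lattice -/
lemma summable_weight (s : ℝ) (hs : 1 < s) :
    Summable (fun l : ℤ × ℤ => (1 + nsq l) ^ (-s)) := by
  have h1 := summable_one_dim s hs
  have h2 := Summable.mul_of_nonneg h1 h1 (fun x => by positivity) (fun x => by positivity)
  refine Summable.of_nonneg_of_le (fun l => (Real.rpow_pos_of_pos (one_add_nsq_pos l) _).le)
    (fun l => ?_) h2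
  have e : (1 + nsq l) ^ (-s) = (1 + nsq l) ^ (-(s / 2)) * (1 + nsq l) ^ (-(s / 2)) := by
    rw [← Real.rpow_add (one_add_nsq_pos l)]
    congr 1
    ring
  rw [e]
  refine mul_le_mul ?_ ?_ (Real.rpow_pos_of_pos (one_add_nsq_pos l) _).le (by positivity)
  · apply Real.rpow_le_rpow_of_nonpos (by positivity)
    · unfold nsq; nlinarith [sq_nonneg (l.2 : ℝ)]
    · linarith
  · apply Real.rpow_le_rpow_of_nonpos (by positivity)
    · unfold nsq; nlinarith [sq_nonneg (l.1 : ℝ)]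
    · linarith

/-- if `z ≤ 4 u` then `u ^ (-b) ≤ 4 * z ^ (-b)`. -/
lemma rpow_neg_compare (z u b : ℝ) (hz : 0 < z) (hu : z ≤ 4 * u) (hb : 0 ≤ b) (hb1 : b ≤ 1) :
    u ^ (-b) ≤ 4 * z ^ (-b) := by
  have hu0 : 0 < u := by linarith
  have h1 : (4 * u) ^ (-b) ≤ z ^ (-b) :=
    Real.rpow_le_rpow_of_nonpos hz hu (by linarith)
  have h2 : u ^ (-b) = 4 ^ b * (4 * u) ^ (-b) := by
    rw [Real.mul_rpow (by norm_num) hu0.le, ← mul_assoc, ← Real.rpow_add (by norm_num)]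
    simp
  have h3 : (4 : ℝ) ^ b ≤ 4 := by
    calc (4 : ℝ) ^ b ≤ 4 ^ (1 : ℝ) := Real.rpow_le_rpow_of_exponent_le (by norm_num) hb1
      _ = 4 := Real.rpow_one 4
  rw [h2]
  exact mul_le_mul h3 h1 (Real.rpow_nonneg (by linarith) _) (by norm_num)

lemma pointwise_bound (x y z a b : ℝ) (hx : 0 < x) (hy : 0 < y) (hz : 0 < z)
    (h : z ≤ 2 * x + 2 * y) (hb : 0 ≤ b) (hab : b ≤ a) (ha : a ≤ 1) :
    x ^ (-1 : ℝ) * y ^ (-a) ≤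
      4 * z ^ (-b) * (x ^ (-(1 + a - b)) + y ^ (-(1 + a - b))) := by
  have pz : 0 < z ^ (-b) := Real.rpow_pos_of_pos hz _
  have px : 0 < x ^ (-(1 + a - b)) := Real.rpow_pos_of_pos hx _
  have py : 0 < y ^ (-(1 + a - b)) := Real.rpow_pos_of_pos hy _
  rcases le_total x y with hxy | hxy
  · have h1 := rpow_neg_compare z y b hz (by linarith) hb (by linarith)
    have h2 : y ^ (-(a - b)) ≤ x ^ (-(a - b)) :=
      Real.rpow_le_rpow_of_nonpos hx hxy (by linarith)
    have e1 : y ^ (-a) = y ^ (-b) * y ^ (-(a - b)) := by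
      rw [← Real.rpow_add hy]; congr 1; ring
    have e2 : x ^ (-(1 + a - b)) = x ^ (-1 : ℝ) * x ^ (-(a - b)) := by
      rw [← Real.rpow_add hx]; congr 1; ring
    calc x ^ (-1 : ℝ) * y ^ (-a) ≤ x ^ (-1 : ℝ) * ((4 * z ^ (-b)) * x ^ (-(a - b))) := by
          rw [e1]; gcongr
      _ = 4 * z ^ (-b) * x ^ (-(1 + a - b)) := by rw [e2]; ring
      _ ≤ _ := by gcongr; linarith
  · have h1 := rpow_neg_compare z x b hz (by linarith) hb (by linarith)
    have h2 : x ^ (-(1 - b)) ≤ y ^ (-(1 - b)) :=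
      Real.rpow_le_rpow_of_nonpos hy hxy (by linarith)
    have e1 : x ^ (-1 : ℝ) = x ^ (-b) * x ^ (-(1 - b)) := by
      rw [← Real.rpow_add hx]; congr 1; ring
    have e2 : y ^ (-(1 + a - b)) = y ^ (-(1 - b)) * y ^ (-a) := by
      rw [← Real.rpow_add hy]; congr 1; ring
    calc x ^ (-1 : ℝ) * y ^ (-a) ≤ ((4 * z ^ (-b)) * y ^ (-(1 - b))) * y ^ (-a) := by
          rw [e1]; gcongr
      _ = 4 * z ^ (-b) * y ^ (-(1 + a - b)) := by rw [e2]; ring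
      _ ≤ _ := by gcongr; linarith

/-- The convolution estimate, for any family dominated by the product of the two kernels. -/
lemma conv_bound (a b C D : ℝ) (hb : 0 ≤ b) (hab : b < a) (ha : a ≤ 1) (hC : 0 < C) (hD : 0 < D)
    (K F : ℤ × ℤ → ℝ) (hK0 : ∀ m, 0 < K m) (hK : ∀ m, K m ≤ C * (1 + nsq m) ^ (-1 : ℝ))
    (hF0 : ∀ m, 0 ≤ F m) (hF : ∀ m, F m ≤ D * (1 + nsq m) ^ (-a)) (m : ℤ × ℤ)
    (g : ℤ × ℤ → ℝ) (hg0 : ∀ l, 0 ≤ g l) (hg : ∀ l, g l ≤ K (m - l) * F l) :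
    ∑' l, g l ≤
      (8 * C * D * ∑' l : ℤ × ℤ, (1 + nsq l) ^ (-(1 + a - b))) * (1 + nsq m) ^ (-b) := by
  have hS := summable_weight (1 + a - b) (by linarith)
  have hS' : Summable (fun l : ℤ × ℤ => (1 + nsq (m - l)) ^ (-(1 + a - b))) :=
    (Equiv.subLeft m).summable_iff.mpr hS
  have eS : ∑' l : ℤ × ℤ, (1 + nsq (m - l)) ^ (-(1 + a - b)) =
      ∑' l : ℤ × ℤ, (1 + nsq l) ^ (-(1 + a - b)) :=
    (Equiv.subLeft m).tsum_eq (fun l : ℤ × ℤ => (1 + nsq l) ^ (-(1 + a - b)))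
  have hle : ∀ l, g l ≤ (C * D * (4 * (1 + nsq m) ^ (-b))) *
      ((1 + nsq (m - l)) ^ (-(1 + a - b)) + (1 + nsq l) ^ (-(1 + a - b))) := by
    intro l
    have hp := pointwise_bound (1 + nsq (m - l)) (1 + nsq l) (1 + nsq m) a b
      (one_add_nsq_pos _) (one_add_nsq_pos _) (one_add_nsq_pos _) (nsq_peetre m l) hb hab.le ha
    calc g l ≤ K (m - l) * F l := hg l
      _ ≤ (C * (1 + nsq (m - l)) ^ (-1 : ℝ)) * (D * (1 + nsq l) ^ (-a)) :=
          mul_le_mul (hK _) (hF _) (hF0 _) ((hK0 _).le.trans (hK _))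
      _ = (C * D) * ((1 + nsq (m - l)) ^ (-1 : ℝ) * (1 + nsq l) ^ (-a)) := by ring
      _ ≤ (C * D) * _ := mul_le_mul_of_nonneg_left hp (by positivity)
      _ = _ := by ring
  have hM := (hS'.add hS).mul_left (C * D * (4 * (1 + nsq m) ^ (-b)))
  have hgs : Summable g := Summable.of_nonneg_of_le hg0 hle hM
  refine (hgs.tsum_le_tsum hle hM).trans (le_of_eq ?_)
  rw [tsum_mul_left, hS'.tsum_add hS, eS]
  ring

lemma iterConv_nonneg (K : ℤ × ℤ → ℝ) (hK : ∀ m, 0 < K m) (n : ℕ) :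
    ∀ m, 0 ≤ iterConv K (n + 1) m := by
  induction n with
  | zero => exact fun m => (hK m).le
  | succ k ih => exact fun m => tsum_nonneg fun l => mul_nonneg (hK _).le (ih l)

lemma iterConvLE_nonneg (N : ℕ) (K : ℤ × ℤ → ℝ) (hK : ∀ m, 0 < K m) (n : ℕ) :
    ∀ m, 0 ≤ iterConvLE N K (n + 1) m := by
  induction n with
  | zero => exact fun m => (hK m).le
  | succ k ih =>
    exact fun m => tsum_nonneg fun l =>
      Set.indicator_nonneg (fun l _ => mul_nonneg (hK _).le (ih l)) l

lemma main_bound (C : ℝ) (hC : 0 < C) (n : ℕ) : ∀ ε : ℝ, 0 < ε → ε < 1 →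
    ∃ Cε : ℝ, 0 < Cε ∧
      ∀ K : ℤ × ℤ → ℝ,
        (∀ m, 0 < K m) →
        (∀ m, K m ≤ C * (1 + nsq m) ^ (-1 : ℝ)) →
        ∀ m : ℤ × ℤ,
          iterConv K (n + 1) m ≤ Cε * (1 + nsq m) ^ (ε - 1) ∧
          ∀ N : ℕ, 1 ≤ N → iterConvLE N K (n + 1) m ≤ Cε * (1 + nsq m) ^ (ε - 1) := by
  induction n with
  | zero =>
    intro ε h0 h1
    refine ⟨C, hC, fun K hK0 hK m => ?_⟩
    have h : K m ≤ C * (1 + nsq m) ^ (ε - 1) := by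
      refine (hK m).trans (mul_le_mul_of_nonneg_left ?_ hC.le)
      exact Real.rpow_le_rpow_of_exponent_le (by linarith [nsq_nonneg m]) (by linarith)
    exact ⟨h, fun N _ => h⟩
  | succ k ih =>
    intro ε h0 h1
    obtain ⟨D, hD, hb⟩ := ih (ε / 2) (by linarith) (by linarith)
    have ea : ε / 2 - 1 = -(1 - ε / 2) := by ring
    have eb : ε - 1 = -(1 - ε) := by ring
    rw [ea] at hb
    rw [eb]
    have hS := summable_weight (1 + (1 - ε / 2) - (1 - ε)) (by linarith)
    refine ⟨8 * C * D * ∑' l : ℤ × ℤ, (1 + nsq l) ^ (-(1 + (1 - ε / 2) - (1 - ε))), ?_, ?_⟩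
    · have : 0 < ∑' l : ℤ × ℤ, (1 + nsq l) ^ (-(1 + (1 - ε / 2) - (1 - ε))) :=
        hS.tsum_pos (fun l => (Real.rpow_pos_of_pos (one_add_nsq_pos l) _).le) 0
          (Real.rpow_pos_of_pos (one_add_nsq_pos 0) _)
      positivity
    · intro K hK0 hK m
      refine ⟨?_, fun N hN => ?_⟩
      · have hF0 := iterConv_nonneg K hK0 k
        exact conv_bound (1 - ε / 2) (1 - ε) C D (by linarith) (by linarith) (by linarith) hC hD
          K (iterConv K (k + 1)) hK0 hK hF0 (fun m => (hb K hK0 hK m).1) m _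
          (fun l => mul_nonneg (hK0 _).le (hF0 l)) (fun l => le_rfl)
      · have hF0 := iterConvLE_nonneg N K hK0 k
        exact conv_bound (1 - ε / 2) (1 - ε) C D (by linarith) (by linarith) (by linarith) hC hD
          K (iterConvLE N K (k + 1)) hK0 hK hF0 (fun m => (hb K hK0 hK m).2 N hN) m _
          (fun l => Set.indicator_nonneg (fun l _ => mul_nonneg (hK0 _).le (hF0 l)) l)
          (fun l => Set.indicator_le_self' (fun l _ => mul_nonneg (hK0 _).le (hF0 l)) l)

theorem stmt_10 (n : ℕ) (hn : 1 ≤ n) (C : ℝ) (hC : 0 < C)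
    (ε : ℝ) (hε0 : 0 < ε) (hε1 : ε < 1) :
    ∃ Cε : ℝ, 0 < Cε ∧
      ∀ K : ℤ × ℤ → ℝ,
        (∀ m, 0 < K m) →
        (∀ m, K m ≤ C * (1 + nsq m) ^ (-1 : ℝ)) →
        ∀ m : ℤ × ℤ,
          iterConv K n m ≤ Cε * (1 + nsq m) ^ (ε - 1) ∧
          ∀ N : ℕ, 1 ≤ N → iterConvLE N K n m ≤ Cε * (1 + nsq m) ^ (ε - 1) := by
  obtain ⟨k, rfl⟩ : ∃ k, n = k + 1 := ⟨n - 1, by omega⟩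
  exact main_bound C hC k ε hε0 hε1
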